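/- arXiv:2603.03082 — 4 statements merged into one kernel-verified Lean document; each statement's English description precedes it below -/
import Mathlib

section
/- Under the uniform local ℓ_p stability assumption, for every nonempty compact set X ⊆ D̃ one has R(X,k) ⊆ 𝒳 for all k ∈ ℤ≥0 and d_H^a(R(X,k),𝒜) → 0 as k → ∞. -/
open Metric Set Filter Topology TopologicalSpace ENNReal

noncomputable section

abbrev Euc (n : ℕ) : Type := EuclideanSpace ℝ (Fin n)

/-- Trajectory of the discrete-time uncertain system `x_{k+1} = f (x_k) (w_k)`. -/
def traj {n m : ℕ} (f : Euc n → Euc m → Euc n) (x : Euc n) (π : ℕ → Euc m) : ℕ → Euc n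
  | 0 => x
  | k + 1 => f (traj f x π k) (π k)

/-- Reachable set of `X` at time `k` under disturbance signals taking values in `W`. -/
def reach {n m : ℕ} (f : Euc n → Euc m → Euc n) (W : Set (Euc m)) (X : Set (Euc n)) (k : ℕ) :
    Set (Euc n) :=
  {y | ∃ x ∈ X, ∃ π : ℕ → Euc m, (∀ j, π j ∈ W) ∧ y = traj f x π k}

/-- The one-step set-valued map `F(X) = {f x w : x ∈ X, w ∈ W}`. -/
def Fmap {n m : ℕ} (f : Euc n → Euc m → Euc n) (W : Set (Euc m)) (X : Set (Euc n)) :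
    Set (Euc n) :=
  Set.image2 f X W

/-- Asymmetric (directed) Hausdorff distance `sup_{x ∈ A} dist(x, B)`. -/
def dHa {n : ℕ} (A B : Set (Euc n)) : ℝ := ⨆ x : A, Metric.infDist (x : Euc n) B

/-- Uniform local ℓ_p stability of the robust invariant set `𝒜` within the safe set `𝒳`. -/
structure LpStable {n m : ℕ} (f : Euc n → Euc m → Euc n) (W : Set (Euc m))
    (𝒳 𝒜 : Set (Euc n)) where
  r : ℝ
  M : ℝ
  p : ℝ
  lam : ℝ → ℕ → ℝ
  r_pos : 0 < r
  M_ge_one : 1 ≤ M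
  p_pos : 0 < p
  lam_nonneg : ∀ s ∈ Set.Icc (0 : ℝ) r, ∀ k : ℕ, 0 ≤ lam s k
  lam_cont : ∀ k : ℕ, ContinuousOn (fun s => lam s k) (Set.Icc (0 : ℝ) r)
  lam_mono : ∀ k : ℕ, MonotoneOn (fun s => lam s k) (Set.Icc (0 : ℝ) r)
  lam_zero : ∀ k : ℕ, lam 0 k = 0
  lam_anti : ∀ s ∈ Set.Icc (0 : ℝ) r, ∀ k l : ℕ, k ≤ l → lam s l ≤ lam s k
  lam_le_id : ∀ s ∈ Set.Icc (0 : ℝ) r, lam s 0 ≤ s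
  lam_summable : Summable fun k : ℕ => lam r k ^ p
  stab : ∀ x ∈ 𝒳, Metric.infDist x 𝒜 ≤ r →
    ∀ π : ℕ → Euc m, (∀ j, π j ∈ W) →
      ∀ k : ℕ, Metric.infDist (traj f x π k) 𝒜 ≤ M * lam (Metric.infDist x 𝒜) k

/-- The safe robust domain of uniform attraction. -/
def DOUA {n m : ℕ} (f : Euc n → Euc m → Euc n) (W : Set (Euc m)) (𝒳 𝒜 : Set (Euc n)) :
    Set (Euc n) :=
  {x | (∀ k : ℕ, reach f W {x} k ⊆ 𝒳) ∧
    Filter.Tendsto (fun k => dHa (reach f W {x} k) 𝒜) Filter.atTop (nhds 0)}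

/-- The safe robust domain of attraction. -/
def DOA {n m : ℕ} (f : Euc n → Euc m → Euc n) (W : Set (Euc m)) (𝒳 𝒜 : Set (Euc n)) :
    Set (Euc n) :=
  {x | ∀ π : ℕ → Euc m, (∀ j, π j ∈ W) →
    (∀ k : ℕ, traj f x π k ∈ 𝒳) ∧
      Filter.Tendsto (fun k => Metric.infDist (traj f x π k) 𝒜) Filter.atTop (nhds 0)}

/-- `Ψ(X) = (sup_{y∈X} γ y) * (sup_{y∈X} α y)`. -/
def Psi {n : ℕ} (α : Euc n → ℝ) (γ : Euc n → ℝ≥0∞) (X : Set (Euc n)) : ℝ≥0∞ :=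
  (⨆ y : X, γ (y : Euc n)) * ENNReal.ofReal (⨆ y : X, α (y : Euc n))

/-- The value function `V(X) = Σ_k Ψ(R(X,k))`. -/
def Vval {n m : ℕ} (f : Euc n → Euc m → Euc n) (W : Set (Euc m)) (α : Euc n → ℝ)
    (γ : Euc n → ℝ≥0∞) (X : Set (Euc n)) : ℝ≥0∞ :=
  ∑' k : ℕ, Psi α γ (reach f W X k)

/-- `exp(-a)` for `a ∈ [0,∞]`, with `exp(-∞) = 0`. -/
def expNeg (a : ℝ≥0∞) : ℝ := if a = ⊤ then 0 else Real.exp (-a.toReal)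

/-- The value function `W(X) = 1 - exp(-V(X))`. -/
def Wval {n m : ℕ} (f : Euc n → Euc m → Euc n) (W : Set (Euc m)) (α : Euc n → ℝ)
    (γ : Euc n → ℝ≥0∞) (X : Set (Euc n)) : ℝ :=
  1 - expNeg (Vval f W α γ X)

/-- `ξ(X) = 1 - exp(-Ψ(X))`. -/
def xival {n : ℕ} (α : Euc n → ℝ) (γ : Euc n → ℝ≥0∞) (X : Set (Euc n)) : ℝ :=
  1 - expNeg (Psi α γ X)

/-- `β(X) = exp(Ψ(X)) - 1`. -/
def betaval {n : ℕ} (α : Euc n → ℝ) (γ : Euc n → ℝ≥0∞) (X : Set (Euc n)) : ℝ :=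
  Real.exp ((Psi α γ X).toReal) - 1

/-- Conditions on `α`: continuous with `α̲ dist(x,𝒜)^p̄ ≤ α(x) ≤ ᾱ dist(x,𝒜)^p̄`. -/
def AlphaHyp {n : ℕ} (𝒜 : Set (Euc n)) (α : Euc n → ℝ) (αlow αup pbar : ℝ) : Prop :=
  Continuous α ∧ 0 < αlow ∧ αlow ≤ αup ∧
    ∀ x : Euc n, αlow * Metric.infDist x 𝒜 ^ pbar ≤ α x ∧
      α x ≤ αup * Metric.infDist x 𝒜 ^ pbar

/-- Conditions on `γ`: finite, continuous and `≥ γ̲ > 0` on `𝒳`, `= ∞` outside `𝒳`,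
blowing up along sequences converging to the boundary of `𝒳`. -/
def GammaHyp {n : ℕ} (𝒳 : Set (Euc n)) (γ : Euc n → ℝ≥0∞) (γlow : ℝ) : Prop :=
  (∀ x ∈ 𝒳, γ x ≠ ⊤) ∧ ContinuousOn γ 𝒳 ∧ 0 < γlow ∧
    (∀ x ∈ 𝒳, ENNReal.ofReal γlow ≤ γ x) ∧
    (∀ x ∉ 𝒳, γ x = ⊤) ∧
    ∀ (u : ℕ → Euc n) (x : Euc n), x ∈ frontier 𝒳 →
      Filter.Tendsto u Filter.atTop (nhds x) →
      Filter.Tendsto (fun k => γ (u k)) Filter.atTop (nhds ⊤)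

theorem traj_cont {n m : ℕ} (f : Euc n → Euc m → Euc n)
    (hf : Continuous fun p : Euc n × Euc m => f p.1 p.2) (k : ℕ) :
    Continuous fun q : Euc n × (ℕ → Euc m) => traj f q.1 q.2 k := by
  induction k with
  | zero => exact continuous_fst
  | succ k ih =>
    exact hf.comp (ih.prodMk ((continuous_apply k).comp continuous_snd))

theorem traj_shift {n m : ℕ} (f : Euc n → Euc m → Euc n) (x : Euc n) (π : ℕ → Euc m)
    (K j : ℕ) : traj f x π (K + j) = traj f (traj f x π K) (fun i => π (K + i)) j := by
  induction j with
  | zero => rfl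
  | succ j ih =>
    change f (traj f x π (K + j)) (π (K + j)) = f _ _
    rw [ih]

theorem traj_bdd {n m : ℕ} (f : Euc n → Euc m → Euc n)
    (hf : Continuous fun p : Euc n × Euc m => f p.1 p.2)
    (Wd : Set (Euc m)) (hWc : IsCompact Wd) (𝒜 : Set (Euc n)) (x : Euc n) (k : ℕ) :
    BddAbove (Set.range fun y : reach f Wd {x} k => Metric.infDist (y : Euc n) 𝒜) := by
  have hc : IsCompact (Set.univ.pi fun _ : ℕ => Wd) := isCompact_univ_pi fun _ => hWc
  have hg : Continuous fun π : ℕ → Euc m => Metric.infDist (traj f x π k) 𝒜 :=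
    (Metric.continuous_infDist_pt 𝒜).comp
      ((traj_cont f hf k).comp (continuous_const.prodMk continuous_id))
  refine (hc.image hg).bddAbove.mono ?_
  rintro _ ⟨⟨y, x', hx', π, hπ, rfl⟩, rfl⟩
  rw [Set.mem_singleton_iff] at hx'
  subst hx'
  exact ⟨π, fun j _ => hπ j, rfl⟩

theorem stmt5 {n m : ℕ}
    (f : Euc n → Euc m → Euc n) (hf : Continuous fun p : Euc n × Euc m => f p.1 p.2)
    (Wd : Set (Euc m)) (hWne : Wd.Nonempty) (hWc : IsCompact Wd)
    (𝒳 : Set (Euc n)) (h𝒳 : IsOpen 𝒳)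
    (𝒜 : Set (Euc n)) (h𝒜ne : 𝒜.Nonempty) (h𝒜c : IsCompact 𝒜) (h𝒜𝒳 : 𝒜 ⊆ 𝒳)
    (h𝒜inv : ∀ x ∈ 𝒜, ∀ w ∈ Wd, f x w ∈ 𝒜)
    (H : LpStable f Wd 𝒳 𝒜)
    (X : Set (Euc n)) (hXne : X.Nonempty) (hXc : IsCompact X)
    (hXD : X ⊆ DOUA f Wd 𝒳 𝒜) :
    (∀ k : ℕ, reach f Wd X k ⊆ 𝒳) ∧
      Filter.Tendsto (fun k => dHa (reach f Wd X k) 𝒜) Filter.atTop (nhds 0) := by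
  have hsafe : ∀ k : ℕ, reach f Wd X k ⊆ 𝒳 := by
    rintro k _ ⟨x, hx, π, hπ, rfl⟩
    exact (hXD hx).1 k ⟨x, rfl, π, hπ, rfl⟩
  refine ⟨hsafe, ?_⟩
  have hr := H.r_pos
  have hM : 0 < H.M := lt_of_lt_of_le one_pos H.M_ge_one
  have hrm : H.r ∈ Set.Icc (0 : ℝ) H.r := ⟨hr.le, le_rfl⟩
  have hc : IsCompact (Set.univ.pi fun _ : ℕ => Wd) := isCompact_univ_pi fun _ => hWc
  obtain ⟨N, hN⟩ : ∃ N : ℕ, ∀ x ∈ X, ∀ π : ℕ → Euc m, (∀ j, π j ∈ Wd) →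
      ∃ K ≤ N, Metric.infDist (traj f x π K) 𝒜 ≤ H.r := by
    refine hXc.induction_on (p := fun S => ∃ N : ℕ, ∀ x ∈ S, ∀ π : ℕ → Euc m,
      (∀ j, π j ∈ Wd) → ∃ K ≤ N, Metric.infDist (traj f x π K) 𝒜 ≤ H.r) ?_ ?_ ?_ ?_
    · exact ⟨0, fun x hx => hx.elim⟩
    · rintro S T hST ⟨N, hN⟩
      exact ⟨N, fun x hx => hN x (hST hx)⟩
    · rintro S T ⟨N, hN⟩ ⟨N', hN'⟩
      refine ⟨max N N', ?_⟩
      rintro x (hx | hx) π hπ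
      · obtain ⟨K, hK, h⟩ := hN x hx π hπ
        exact ⟨K, hK.trans (le_max_left _ _), h⟩
      · obtain ⟨K, hK, h⟩ := hN' x hx π hπ
        exact ⟨K, hK.trans (le_max_right _ _), h⟩
    · intro x hx
      obtain ⟨K, hK⟩ := ((hXD hx).2.eventually (gt_mem_nhds hr)).exists
      have hlt : ∀ π ∈ (Set.univ.pi fun _ : ℕ => Wd),
          Metric.infDist (traj f x π K) 𝒜 < H.r := by
        intro π hπ
        refine lt_of_le_of_lt ?_ hK
        exact le_ciSup (traj_bdd f hf Wd hWc 𝒜 x K)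
          (⟨traj f x π K, x, rfl, π, fun j => hπ j trivial, rfl⟩ : reach f Wd {x} K)
      have hev : ∀ᶠ x' in 𝓝 x, ∀ π ∈ (Set.univ.pi fun _ : ℕ => Wd),
          Metric.infDist (traj f x' π K) 𝒜 < H.r := by
        refine hc.eventually_forall_of_forall_eventually ?_
        intro π hπ
        have hg : Continuous fun q : Euc n × (ℕ → Euc m) =>
            Metric.infDist (traj f q.1 q.2 K) 𝒜 :=
          (Metric.continuous_infDist_pt 𝒜).comp (traj_cont f hf K)
        have ho : IsOpen {q : Euc n × (ℕ → Euc m) |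
            Metric.infDist (traj f q.1 q.2 K) 𝒜 < H.r} := isOpen_lt hg continuous_const
        have hmem := ho.mem_nhds (show (x, π) ∈ {q : Euc n × (ℕ → Euc m) |
            Metric.infDist (traj f q.1 q.2 K) 𝒜 < H.r} from hlt π hπ)
        exact hmem
      exact ⟨{x' | ∀ π ∈ (Set.univ.pi fun _ : ℕ => Wd),
          Metric.infDist (traj f x' π K) 𝒜 < H.r}, mem_nhdsWithin_of_mem_nhds hev, K, fun x' hx' π hπ =>
        ⟨K, le_rfl, (hx' π fun j _ => hπ j).le⟩⟩
  have hlam : Filter.Tendsto (fun k => H.lam H.r k) Filter.atTop (nhds 0) := by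
    have h1 := H.lam_summable.tendsto_atTop_zero.rpow_const (p := H.p⁻¹)
      (Or.inr (inv_nonneg.2 H.p_pos.le))
    rw [Real.zero_rpow (inv_ne_zero H.p_pos.ne')] at h1
    refine h1.congr fun k => ?_
    exact Real.rpow_rpow_inv (H.lam_nonneg _ hrm k) H.p_pos.ne'
  have hub : Filter.Tendsto (fun k => H.M * H.lam H.r (k - N)) Filter.atTop (nhds 0) := by
    simpa using (hlam.comp (tendsto_sub_atTop_nat N)).const_mul H.M
  refine tendsto_of_tendsto_of_tendsto_of_le_of_le' tendsto_const_nhds hub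
    (Eventually.of_forall fun k => Real.iSup_nonneg fun _ => Metric.infDist_nonneg) ?_
  filter_upwards [eventually_ge_atTop N] with k hk
  refine Real.iSup_le ?_ (mul_nonneg hM.le (H.lam_nonneg _ hrm _))
  rintro ⟨_, x, hx, π, hπ, rfl⟩
  obtain ⟨K, hK, h⟩ := hN x hx π hπ
  obtain ⟨j, rfl⟩ := Nat.exists_eq_add_of_le (hK.trans hk)
  have hs : Metric.infDist (traj f x π K) 𝒜 ∈ Set.Icc (0 : ℝ) H.r := ⟨Metric.infDist_nonneg, h⟩
  have h2 := H.stab _ (hsafe K ⟨x, hx, π, hπ, rfl⟩) h (fun i => π (K + i))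
    (fun i => hπ _) j
  rw [← traj_shift] at h2
  refine h2.trans (mul_le_mul_of_nonneg_left ?_ hM.le)
  exact (H.lam_mono j hs hrm h).trans (H.lam_anti _ hrm _ _ (by omega))

end
end

section
/- Under the uniform local ℓ_p stability assumption, for every nonempty compact set X ⊆ D̃, the set F(X) := {f(x,w) : x ∈ X, w ∈ W} is a nonempty compact subset of D̃; that is, the class of nonempty compact subsets of D̃ is invariant under F. -/
open Metric Set Filter Topology TopologicalSpace ENNReal

noncomputable section

lemma traj_cons {n m : ℕ} (f : Euc n → Euc m → Euc n) (x : Euc n) (w : Euc m) (π : ℕ → Euc m)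
    (k : ℕ) : traj f (f x w) π k = traj f x (fun j => Nat.casesOn j w π) (k + 1) := by
  induction k with
  | zero => rfl
  | succ k ih => rw [traj, ih]; rfl

lemma reach_bdd {n m : ℕ} (f : Euc n → Euc m → Euc n)
    (hf : Continuous fun p : Euc n × Euc m => f p.1 p.2)
    (W : Set (Euc m)) (hW : IsCompact W) (x : Euc n) (k : ℕ) :
    ∃ K : Set (Euc n), IsCompact K ∧ reach f W {x} k ⊆ K := by
  induction k with
  | zero =>
    refine ⟨{x}, isCompact_singleton, ?_⟩
    rintro y ⟨x', hx', π, _, rfl⟩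
    exact hx'
  | succ k ih =>
    obtain ⟨K, hK, hs⟩ := ih
    refine ⟨_, (hK.prod hW).image hf, ?_⟩
    rintro y ⟨x', hx', π, hπ, rfl⟩
    exact ⟨(traj f x' π k, π k), ⟨hs ⟨x', hx', π, hπ, rfl⟩, hπ k⟩, rfl⟩

theorem stmt6 {n m : ℕ}
    (f : Euc n → Euc m → Euc n) (hf : Continuous fun p : Euc n × Euc m => f p.1 p.2)
    (Wd : Set (Euc m)) (hWne : Wd.Nonempty) (hWc : IsCompact Wd)
    (𝒳 : Set (Euc n)) (h𝒳 : IsOpen 𝒳)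
    (𝒜 : Set (Euc n)) (h𝒜ne : 𝒜.Nonempty) (h𝒜c : IsCompact 𝒜) (h𝒜𝒳 : 𝒜 ⊆ 𝒳)
    (h𝒜inv : ∀ x ∈ 𝒜, ∀ w ∈ Wd, f x w ∈ 𝒜)
    (H : LpStable f Wd 𝒳 𝒜)
    (X : Set (Euc n)) (hXne : X.Nonempty) (hXc : IsCompact X)
    (hXD : X ⊆ DOUA f Wd 𝒳 𝒜) :
    (Fmap f Wd X).Nonempty ∧ IsCompact (Fmap f Wd X) ∧ Fmap f Wd X ⊆ DOUA f Wd 𝒳 𝒜 := by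
  have hsub : ∀ x, ∀ w ∈ Wd, ∀ k, reach f Wd {f x w} k ⊆ reach f Wd {x} (k + 1) := by
    rintro x w hw k y ⟨x', hx', π, hπ, rfl⟩
    rw [mem_singleton_iff] at hx'
    subst hx'
    refine ⟨x, rfl, _, ?_, traj_cons f x w π k⟩
    intro j
    cases j with
    | zero => exact hw
    | succ j => exact hπ j
  refine ⟨hXne.image2 hWne, ?_, ?_⟩
  · have h := (hXc.prod hWc).image hf
    rwa [image_prod] at h
  · rintro y ⟨x, hx, w, hw, rfl⟩
    obtain ⟨h1, h2⟩ := hXD hx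
    refine ⟨fun k => (hsub x w hw k).trans (h1 (k + 1)), ?_⟩
    refine squeeze_zero (fun k => Real.iSup_nonneg fun _ => infDist_nonneg) (fun k => ?_)
      ((tendsto_add_atTop_iff_nat 1).2 h2)
    obtain ⟨K, hK, hs⟩ := reach_bdd f hf Wd hWc x (k + 1)
    obtain ⟨B, hB⟩ := (hK.image (continuous_infDist_pt 𝒜)).bddAbove
    refine Real.iSup_le (fun z => ?_) (Real.iSup_nonneg fun _ => infDist_nonneg)
    exact le_ciSup (f := fun z : reach f Wd {x} (k + 1) => infDist (z : Euc n) 𝒜)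
      ⟨B, by rintro _ ⟨z, rfl⟩; exact hB ⟨z, hs z.2, rfl⟩⟩ ⟨z, hsub x w hw k z.2⟩

end
end

section
/- Under the uniform local ℓ_p stability assumption, the safe robust domain of attraction equals the safe robust domain of uniform attraction: D = D̃. -/
open Metric Set Filter Topology TopologicalSpace ENNReal

noncomputable section

theorem traj_continuous {n m : ℕ}
    (f : Euc n → Euc m → Euc n) (hf : Continuous fun p : Euc n × Euc m => f p.1 p.2)
    (x : Euc n) (k : ℕ) : Continuous fun π : ℕ → Euc m => traj f x π k := by
  induction k with
  | zero => exact continuous_const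
  | succ k ih => exact hf.comp (ih.prodMk (continuous_apply k))

theorem traj_add {n m : ℕ} (f : Euc n → Euc m → Euc n) (x : Euc n) (π : ℕ → Euc m) (k j : ℕ) :
    traj f x π (k + j) = traj f (traj f x π k) (fun i => π (k + i)) j := by
  induction j with
  | zero => rfl
  | succ j ih =>
    change f (traj f x π (k + j)) (π (k + j)) = _
    rw [ih]; rfl

theorem stmt7 {n m : ℕ}
    (f : Euc n → Euc m → Euc n) (hf : Continuous fun p : Euc n × Euc m => f p.1 p.2)
    (Wd : Set (Euc m)) (hWne : Wd.Nonempty) (hWc : IsCompact Wd)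
    (𝒳 : Set (Euc n)) (h𝒳 : IsOpen 𝒳)
    (𝒜 : Set (Euc n)) (h𝒜ne : 𝒜.Nonempty) (h𝒜c : IsCompact 𝒜) (h𝒜𝒳 : 𝒜 ⊆ 𝒳)
    (h𝒜inv : ∀ x ∈ 𝒜, ∀ w ∈ Wd, f x w ∈ 𝒜)
    (H : LpStable f Wd 𝒳 𝒜)
    : DOA f Wd 𝒳 𝒜 = DOUA f Wd 𝒳 𝒜 := by
  have hP : IsCompact {π : ℕ → Euc m | ∀ j, π j ∈ Wd} := isCompact_pi_infinite fun _ => hWc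
  have hc : ∀ x k, Continuous fun π : ℕ → Euc m => Metric.infDist (traj f x π k) 𝒜 := fun x k =>
    (Metric.continuous_infDist_pt 𝒜).comp (traj_continuous f hf x k)
  ext x
  constructor
  · intro hx
    refine ⟨?_, ?_⟩
    · rintro k y ⟨x', hx', π, hπ, rfl⟩
      rw [Set.mem_singleton_iff] at hx'
      subst hx'
      exact (hx π hπ).1 k
    · have hr0 : (H.r) ∈ Set.Icc (0 : ℝ) H.r := ⟨H.r_pos.le, le_rfl⟩
      obtain ⟨t, ht⟩ := hP.elim_finite_subcover
        (fun k : ℕ => {π : ℕ → Euc m | Metric.infDist (traj f x π k) 𝒜 < H.r})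
        (fun k => isOpen_lt (hc x k) continuous_const)
        (by
          intro π hπ
          obtain ⟨k, hk⟩ := ((hx π hπ).2.eventually (gt_mem_nhds H.r_pos)).exists
          exact Set.mem_iUnion.2 ⟨k, hk⟩)
      have hlam : Tendsto (fun k => H.lam H.r k) atTop (nhds 0) := by
        have h1 := H.lam_summable.tendsto_atTop_zero
        have h2 := h1.rpow_const (p := 1 / H.p) (Or.inr (by have := H.p_pos; positivity))
        rw [Real.zero_rpow (by have := H.p_pos; positivity)] at h2
        refine h2.congr fun k => ?_
        rw [← Real.rpow_mul (H.lam_nonneg _ hr0 k), mul_one_div_cancel H.p_pos.ne',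
          Real.rpow_one]
      have hlim : Tendsto (fun K => H.M * H.lam H.r (K - t.sup id)) atTop (nhds 0) := by
        have := (hlam.comp (tendsto_sub_atTop_nat (t.sup id))).const_mul H.M
        simpa using this
      refine tendsto_of_tendsto_of_tendsto_of_le_of_le' tendsto_const_nhds hlim
        (Eventually.of_forall fun K => Real.iSup_nonneg fun _ => Metric.infDist_nonneg) ?_
      filter_upwards [eventually_ge_atTop (t.sup id)] with K hK
      have hM : 0 ≤ H.M := zero_le_one.trans H.M_ge_one
      refine Real.iSup_le ?_ (mul_nonneg hM (H.lam_nonneg _ hr0 _))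
      rintro ⟨y, x', hx', π, hπ, rfl⟩
      rw [Set.mem_singleton_iff] at hx'
      subst hx'
      have hmem := ht hπ
      simp only [Set.mem_iUnion, exists_prop] at hmem
      obtain ⟨k, hkt, hk⟩ := hmem
      have hk' : Metric.infDist (traj f x' π k) 𝒜 < H.r := hk
      have hkN : k ≤ t.sup id := Finset.le_sup (f := id) hkt
      have h1 := H.stab _ ((hx π hπ).1 k) hk'.le (fun i => π (k + i)) (fun i => hπ _) (K - k)
      rw [← traj_add, Nat.add_sub_cancel' (hkN.trans hK)] at h1
      refine h1.trans (mul_le_mul_of_nonneg_left ?_ hM)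
      exact (H.lam_mono (K - k) ⟨Metric.infDist_nonneg, hk'.le⟩ hr0 hk'.le).trans
        (H.lam_anti _ hr0 _ _ (by omega))
  · rintro ⟨h1, h2⟩ π hπ
    have hm : ∀ k, traj f x π k ∈ reach f Wd {x} k := fun k => ⟨x, rfl, π, hπ, rfl⟩
    refine ⟨fun k => h1 k (hm k), ?_⟩
    refine squeeze_zero (fun _ => Metric.infDist_nonneg) (fun k => ?_) h2
    have hb : BddAbove (Set.range fun y : reach f Wd {x} k => Metric.infDist (y : Euc n) 𝒜) := by
      refine (hP.image (hc x k)).bddAbove.mono ?_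
      rintro _ ⟨⟨y, x', hx', π', hπ', rfl⟩, rfl⟩
      rw [Set.mem_singleton_iff] at hx'
      subst hx'
      exact ⟨π', hπ', rfl⟩
    exact le_ciSup hb ⟨_, hm k⟩

end
end

section
/- Under the uniform local ℓ_p stability assumption and the stated conditions on α and γ, suppose w is a real-valued function on the nonempty compact subsets of D̃ that satisfies w(X) − w(F(X)) = ξ(X)·(1 − w(F(X))) for all nonempty compact X ⊆ D̃ (where ξ(X) := 1 − exp(−Ψ(X))), and that satisfies: for every nonempty compact X, if d_H^a(R(X,k),𝒜) → 0 as k → ∞ then w(R(X,k)) → 0. Then w(X) < 1 for every nonempty compact X ⊆ D̃. -/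
open Metric Set Filter Topology TopologicalSpace ENNReal

noncomputable section

theorem aux_traj_cont {n m : ℕ} (f : Euc n → Euc m → Euc n)
    (hf : Continuous fun p : Euc n × Euc m => f p.1 p.2) (k : ℕ) :
    Continuous (fun q : Euc n × (ℕ → Euc m) => traj f q.1 q.2 k) := by
  induction k with
  | zero => exact continuous_fst
  | succ k ih =>
    have h2 : Continuous (fun q : Euc n × (ℕ → Euc m) => q.2 k) :=
      (continuous_apply k).comp continuous_snd
    exact hf.comp (ih.prodMk h2)

theorem aux_traj_add {n m : ℕ} (f : Euc n → Euc m → Euc n) (x : Euc n) (π : ℕ → Euc m)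
    (N j : ℕ) : traj f x π (N + j) = traj f (traj f x π N) (fun i => π (N + i)) j := by
  induction j with
  | zero => rfl
  | succ j ih =>
    show f (traj f x π (N + j)) (π (N + j)) = _
    rw [ih]; rfl

theorem aux_traj_congr {n m : ℕ} (f : Euc n → Euc m → Euc n) (x : Euc n) (π σ : ℕ → Euc m)
    (k : ℕ) (h : ∀ j < k, π j = σ j) : traj f x π k = traj f x σ k := by
  induction k with
  | zero => rfl
  | succ k ih =>
    show f (traj f x π k) (π k) = f (traj f x σ k) (σ k)
    rw [ih (fun j hj => h j (by omega)), h k (by omega)]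

theorem aux_reach_compact {n m : ℕ} (f : Euc n → Euc m → Euc n)
    (hf : Continuous fun p : Euc n × Euc m => f p.1 p.2) (W : Set (Euc m)) (hW : IsCompact W)
    (X : Set (Euc n)) (hX : IsCompact X) (k : ℕ) : IsCompact (reach f W X k) := by
  have h1 : IsCompact (Set.univ.pi (fun _ : ℕ => W)) := isCompact_univ_pi (fun _ => hW)
  have h2 := (hX.prod h1).image (aux_traj_cont f hf k)
  convert h2 using 1
  ext y
  constructor
  · rintro ⟨x, hx, π, hπ, rfl⟩
    exact ⟨(x, π), ⟨hx, fun j _ => hπ j⟩, rfl⟩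
  · rintro ⟨⟨x, π⟩, ⟨hx, hπ⟩, rfl⟩
    exact ⟨x, hx, π, fun j => hπ j (Set.mem_univ j), rfl⟩

theorem aux_le_dHa {n : ℕ} (S A : Set (Euc n)) (hS : IsCompact S) (z : Euc n) (hz : z ∈ S) :
    infDist z A ≤ dHa S A := by
  have hb : BddAbove (Set.range (fun x : S => infDist (x : Euc n) A)) := by
    have := (hS.image (continuous_infDist_pt A)).bddAbove
    rwa [Set.image_eq_range] at this
  exact le_ciSup hb ⟨z, hz⟩

theorem aux_dHa_nonneg {n : ℕ} (S A : Set (Euc n)) : 0 ≤ dHa S A :=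
  Real.iSup_nonneg (fun _ => infDist_nonneg)

theorem aux_reach_zero {n m : ℕ} (f : Euc n → Euc m → Euc n) (W : Set (Euc m))
    (hW : W.Nonempty) (X : Set (Euc n)) : reach f W X 0 = X := by
  obtain ⟨w, hw⟩ := hW
  ext y
  constructor
  · rintro ⟨x, hx, π, hπ, rfl⟩
    exact hx
  · intro hy
    exact ⟨y, hy, fun _ => w, fun _ => hw, rfl⟩

theorem aux_reach_succ {n m : ℕ} (f : Euc n → Euc m → Euc n) (W : Set (Euc m))
    (X : Set (Euc n)) (k : ℕ) : reach f W X (k + 1) = Fmap f W (reach f W X k) := by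
  ext y
  constructor
  · rintro ⟨x, hx, π, hπ, rfl⟩
    exact ⟨traj f x π k, ⟨x, hx, π, hπ, rfl⟩, π k, hπ k, rfl⟩
  · rintro ⟨z, ⟨x, hx, π, hπ, rfl⟩, w, hw, rfl⟩
    refine ⟨x, hx, fun j => if j < k then π j else w, ?_, ?_⟩
    · intro j
      dsimp only
      split_ifs
      exacts [hπ j, hw]
    · show _ = f (traj f x _ k) (if k < k then π k else w)
      rw [aux_traj_congr f x (fun j => if j < k then π j else w) π k
        (fun j hj => by simp [hj])]
      simp

theorem aux_reach_step {n m : ℕ} (f : Euc n → Euc m → Euc n) (W : Set (Euc m))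
    (x : Euc n) (w : Euc m) (hw : w ∈ W) (k : ℕ) :
    reach f W {f x w} k ⊆ reach f W {x} (k + 1) := by
  rintro y ⟨z, rfl, π, hπ, rfl⟩
  refine ⟨x, rfl, fun j => Nat.casesOn j w π, ?_, ?_⟩
  · intro j
    cases j with
    | zero => exact hw
    | succ j => exact hπ j
  · rw [add_comm k 1, aux_traj_add]
    have : (fun i => (fun j => Nat.casesOn j w π : ℕ → Euc m) (1 + i)) = π := by
      funext i
      simp only [add_comm 1 i]
    rw [this]
    rfl

theorem aux_DOUA_step {n m : ℕ} (f : Euc n → Euc m → Euc n)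
    (hf : Continuous fun p : Euc n × Euc m => f p.1 p.2) (W : Set (Euc m)) (hW : IsCompact W)
    (𝒳 𝒜 : Set (Euc n)) (S : Set (Euc n)) (hS : S ⊆ DOUA f W 𝒳 𝒜) :
    Fmap f W S ⊆ DOUA f W 𝒳 𝒜 := by
  rintro y ⟨x, hx, w, hw, rfl⟩
  obtain ⟨h1, h2⟩ := hS hx
  refine ⟨fun k => (aux_reach_step f W x w hw k).trans (h1 (k + 1)), ?_⟩
  refine squeeze_zero (fun k => aux_dHa_nonneg _ _) (fun k => ?_)
    (h2.comp (tendsto_add_atTop_nat 1))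
  refine Real.iSup_le ?_ (aux_dHa_nonneg _ _)
  rintro ⟨z, hz⟩
  exact aux_le_dHa _ _ (aux_reach_compact f hf W hW {x} isCompact_singleton (k + 1)) z
    (aux_reach_step f W x w hw k hz)

theorem aux_lam {n m : ℕ} {f : Euc n → Euc m → Euc n} {W : Set (Euc m)}
    {𝒳 𝒜 : Set (Euc n)} (H : LpStable f W 𝒳 𝒜) :
    Tendsto (fun k => H.lam H.r k) atTop (𝓝 0) := by
  have h1 := H.lam_summable.tendsto_atTop_zero
  have hp := H.p_pos
  have h2 := (Real.continuousAt_rpow_const 0 (1 / H.p) (Or.inr (by positivity))).tendsto.comp h1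
  rw [Real.zero_rpow (by positivity)] at h2
  refine h2.congr (fun k => ?_)
  have h0 := H.lam_nonneg H.r ⟨H.r_pos.le, le_rfl⟩ k
  simp only [Function.comp]
  rw [← Real.rpow_mul h0, mul_one_div_cancel hp.ne', Real.rpow_one]

theorem aux_unif {n m : ℕ} (f : Euc n → Euc m → Euc n)
    (hf : Continuous fun p : Euc n × Euc m => f p.1 p.2) (W : Set (Euc m)) (hW : IsCompact W)
    (𝒳 𝒜 : Set (Euc n)) (H : LpStable f W 𝒳 𝒜)
    (X : Set (Euc n)) (hX : IsCompact X) (hXD : X ⊆ DOUA f W 𝒳 𝒜) (ε : ℝ) (hε : 0 < ε) :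
    ∀ᶠ k in atTop, ∀ y ∈ X, ∀ π : ℕ → Euc m, (∀ j, π j ∈ W) →
      infDist (traj f y π k) 𝒜 ≤ ε := by
  suffices h : ∀ᶠ k in atTop, ∀ y ∈ X, y ∈ X → ∀ π : ℕ → Euc m, (∀ j, π j ∈ W) →
      infDist (traj f y π k) 𝒜 ≤ ε from h.mono (fun k hk y hy => hk y hy hy)
  refine hX.induction_on (p := fun S => ∀ᶠ k in atTop, ∀ y ∈ S, y ∈ X → ∀ π : ℕ → Euc m,
    (∀ j, π j ∈ W) → infDist (traj f y π k) 𝒜 ≤ ε) ?_ ?_ ?_ ?_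
  · simp
  · intro s t hst ht
    exact ht.mono (fun k hk y hy => hk y (hst hy))
  · intro s t hs ht
    filter_upwards [hs, ht] with k h1 h2 y hy
    exact hy.elim (h1 y) (h2 y)
  · intro x hx
    obtain ⟨N, hN⟩ := ((hXD hx).2.eventually (gt_mem_nhds H.r_pos)).exists
    have hP : IsCompact (Set.univ.pi (fun _ : ℕ => W)) := isCompact_univ_pi (fun _ => hW)
    have hO : IsOpen {q : Euc n × (ℕ → Euc m) | infDist (traj f q.1 q.2 N) 𝒜 < H.r} :=
      isOpen_lt ((continuous_infDist_pt 𝒜).comp (aux_traj_cont f hf N)) continuous_const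
    obtain ⟨U, V, hU, hV, hxU, hPV, hUV⟩ := generalized_tube_lemma
      (isCompact_singleton (x := x)) hP hO (by
        rintro ⟨y, π⟩ ⟨hy, hπ⟩
        obtain rfl : y = x := hy
        refine lt_of_le_of_lt ?_ hN
        exact aux_le_dHa _ _ (aux_reach_compact f hf W hW {y} isCompact_singleton N) _
          ⟨y, rfl, π, fun j => hπ j (Set.mem_univ j), rfl⟩)
    refine ⟨U, mem_nhdsWithin_of_mem_nhds (hU.mem_nhds (hxU rfl)), ?_⟩
    have hl : Tendsto (fun k => H.M * H.lam H.r (k - N)) atTop (𝓝 0) := by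
      have := ((aux_lam H).comp (tendsto_sub_atTop_nat N)).const_mul H.M
      simpa using this
    filter_upwards [hl.eventually (gt_mem_nhds hε), eventually_ge_atTop N] with k hk hkN y hyU hyX
      π hπ
    have hπV : π ∈ V := hPV (Set.mem_univ_pi.2 hπ)
    have hmem : (y, π) ∈ U ×ˢ V := Set.mk_mem_prod hyU hπV
    have hlt : infDist (traj f y π N) 𝒜 < H.r := by
      have h3 := hUV hmem
      rw [Set.mem_setOf_eq] at h3
      exact h3
    have hin : traj f y π N ∈ 𝒳 := (hXD hyX).1 N ⟨y, rfl, π, hπ, rfl⟩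
    have hs := H.stab _ hin hlt.le (fun i => π (N + i)) (fun j => hπ _) (k - N)
    rw [← aux_traj_add, Nat.add_sub_cancel' hkN] at hs
    have hm := H.lam_mono (k - N) ⟨infDist_nonneg, hlt.le⟩ ⟨H.r_pos.le, le_rfl⟩ hlt.le
    have hM := H.M_ge_one
    exact hs.trans ((mul_le_mul_of_nonneg_left hm (by linarith)).trans hk.le)

theorem aux_Psi {n : ℕ} (𝒳 : Set (Euc n)) (α : Euc n → ℝ) (γ : Euc n → ℝ≥0∞)
    (h1 : ∀ x ∈ 𝒳, γ x ≠ ⊤) (h2 : ContinuousOn γ 𝒳) (S : Set (Euc n)) (hS : IsCompact S)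
    (hne : S.Nonempty) (hS𝒳 : S ⊆ 𝒳) : Psi α γ S ≠ ⊤ := by
  refine ENNReal.mul_ne_top ?_ ENNReal.ofReal_ne_top
  obtain ⟨x, hx, hmax⟩ := hS.exists_isMaxOn hne (h2.mono hS𝒳)
  refine ne_top_of_le_ne_top (h1 x (hS𝒳 hx)) (iSup_le ?_)
  rintro ⟨y, hy⟩
  exact hmax hy

theorem stmt16 {n m : ℕ}
    (f : Euc n → Euc m → Euc n) (hf : Continuous fun p : Euc n × Euc m => f p.1 p.2)
    (Wd : Set (Euc m)) (hWne : Wd.Nonempty) (hWc : IsCompact Wd)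
    (𝒳 : Set (Euc n)) (h𝒳 : IsOpen 𝒳)
    (𝒜 : Set (Euc n)) (h𝒜ne : 𝒜.Nonempty) (h𝒜c : IsCompact 𝒜) (h𝒜𝒳 : 𝒜 ⊆ 𝒳)
    (h𝒜inv : ∀ x ∈ 𝒜, ∀ w ∈ Wd, f x w ∈ 𝒜)
    (H : LpStable f Wd 𝒳 𝒜)
    (α : Euc n → ℝ) (αlow αup pbar : ℝ) (hα : AlphaHyp 𝒜 α αlow αup pbar)
    (hpbar : H.p ≤ pbar)
    (γ : Euc n → ℝ≥0∞) (γlow : ℝ) (hγ : GammaHyp 𝒳 γ γlow)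
    (w : Set (Euc n) → ℝ)
    (hw : ∀ X : Set (Euc n), X.Nonempty → IsCompact X → X ⊆ DOUA f Wd 𝒳 𝒜 →
      w X - w (Fmap f Wd X) = xival α γ X * (1 - w (Fmap f Wd X)))
    (hlim : ∀ X : Set (Euc n), X.Nonempty → IsCompact X →
      Filter.Tendsto (fun k => dHa (reach f Wd X k) 𝒜) Filter.atTop (nhds 0) →
      Filter.Tendsto (fun k => w (reach f Wd X k)) Filter.atTop (nhds 0)) :
    ∀ X : Set (Euc n), X.Nonempty → IsCompact X → X ⊆ DOUA f Wd 𝒳 𝒜 → w X < 1 := by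
  intro X hXne hXc hXD
  have hD : ∀ k, reach f Wd X k ⊆ DOUA f Wd 𝒳 𝒜 := by
    intro k
    induction k with
    | zero => rwa [aux_reach_zero f Wd hWne]
    | succ k ih =>
      rw [aux_reach_succ]
      exact aux_DOUA_step f hf Wd hWc 𝒳 𝒜 _ ih
  have hne : ∀ k, (reach f Wd X k).Nonempty := by
    intro k
    obtain ⟨x, hx⟩ := hXne
    obtain ⟨v, hv⟩ := hWne
    exact ⟨_, x, hx, fun _ => v, fun _ => hv, rfl⟩
  have hto : Tendsto (fun k => dHa (reach f Wd X k) 𝒜) atTop (𝓝 0) := by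
    rw [Metric.tendsto_atTop']
    intro ε hε
    obtain ⟨N, hN⟩ := eventually_atTop.1
      (aux_unif f hf Wd hWc 𝒳 𝒜 H X hXc hXD (ε / 2) (by positivity))
    refine ⟨N, fun k hk => ?_⟩
    rw [Real.dist_eq, sub_zero, abs_of_nonneg (aux_dHa_nonneg _ _)]
    refine lt_of_le_of_lt (Real.iSup_le ?_ (by positivity)) (half_lt_self hε)
    rintro ⟨z, x, hx, π, hπ, rfl⟩
    exact hN k hk.le x hx π hπ
  obtain ⟨N, hN⟩ := ((hlim X hXne hXc hto).eventually (gt_mem_nhds one_pos)).exists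
  have hstep : ∀ k, w (reach f Wd X (k + 1)) < 1 → w (reach f Wd X k) < 1 := by
    intro k hk
    have hc := aux_reach_compact f hf Wd hWc X hXc k
    have h := hw _ (hne k) hc (hD k)
    rw [← aux_reach_succ] at h
    have hsub : reach f Wd X k ⊆ 𝒳 := by
      intro z hz
      have := ((hD k) hz).1 0
      rw [aux_reach_zero f Wd hWne] at this
      exact this rfl
    have hP := aux_Psi 𝒳 α γ hγ.1 hγ.2.1 _ hc (hne k) hsub
    have he : 0 < expNeg (Psi α γ (reach f Wd X k)) := by
      rw [expNeg, if_neg hP]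
      exact Real.exp_pos _
    unfold xival at h
    nlinarith [mul_pos he (sub_pos.2 hk)]
  have hfin : ∀ N, w (reach f Wd X N) < 1 → w (reach f Wd X 0) < 1 := by
    intro N
    induction N with
    | zero => exact id
    | succ N ih => exact fun h => ih (hstep N h)
  have := hfin N hN
  rwa [aux_reach_zero f Wd hWne] at this

end
end
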